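/- Assume f : [1,∞) → (0,∞) satisfies condition (B): for some β > 0 the function x ↦ f(x)/x^β is increasing, and assume (t, ω) ↦ V(f(t), ω) is jointly measurable. Then for almost every ω ∈ Ω, for every bounded continuous function g : ℝ → ℝ, one has (1/log T) ∫_1^T g(V(f(t), ω)/√f(t))·(1/t) dt → ∫ g dN(0, σ²) as T → ∞; that is, (1/log T) ∫_1^T δ_{V(f(t),ω)/√f(t)} (1/t) dt converges weakly to the centered Gaussian distribution with variance σ² almost surely. (Integral-type almost sure central limit theorem stated in the Introduction.) -/

import Mathlib

open MeasureTheory ProbabilityTheory Filter Topology NNReal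


lemma exists_countable_class :
    ∃ H : Finset ℕ → ℕ → ℝ → ℝ, (∀ F n, (∀ x, |H F n x| ≤ 1) ∧ ∃ L : ℝ≥0, LipschitzWith L (H F n)) ∧
      ∀ (μs : ℝ → ProbabilityMeasure ℝ) (μ : ProbabilityMeasure ℝ),
        (∀ F n, Tendsto (fun T => ∫ x, H F n x ∂(μs T : Measure ℝ)) atTop
          (𝓝 (∫ x, H F n x ∂(μ : Measure ℝ)))) → Tendsto μs atTop (𝓝 μ) := by
  obtain ⟨b, hb⟩ := (TopologicalSpace.countable_countableBasis ℝ).exists_eq_range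
    (by
      have := (TopologicalSpace.isBasis_countableBasis ℝ).sUnion_eq
      by_contra hne
      rw [Set.not_nonempty_iff_eq_empty] at hne
      rw [hne, Set.sUnion_empty] at this
      exact Set.empty_ne_univ this)
  have hbasis := TopologicalSpace.isBasis_countableBasis ℝ
  let CF : Finset ℕ → Set ℝ := fun F => ⋂ i ∈ F, (b i)ᶜ
  have hδ : ∀ n : ℕ, (0:ℝ) < 1 / ((n:ℝ) + 1) := fun n => Nat.one_div_pos_of_nat
  let h : Finset ℕ → ℕ → BoundedContinuousFunction ℝ ℝ≥0 := fun F n => thickenedIndicator (hδ n) (CF F)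
  have hCFcl : ∀ F, IsClosed (CF F) := by
    intro F
    refine isClosed_biInter fun i _ => ?_
    rw [isClosed_compl_iff]
    exact hbasis.isOpen (hb ▸ Set.mem_range_self i)
  refine ⟨fun F n x => (h F n x : ℝ), ?_, ?_⟩
  · intro F n
    constructor
    · intro x
      rw [abs_of_nonneg (NNReal.coe_nonneg _)]
      exact NNReal.coe_le_one.2 (thickenedIndicator_le_one (hδ n) (CF F) x)
    · refine ⟨_, (LipschitzWith.of_dist_le_mul (K := 1) (f := ((↑) : ℝ≥0 → ℝ)) (fun a b => by simp [NNReal.dist_eq, Real.dist_eq])).comp (lipschitzWith_thickenedIndicator (hδ n) (CF F))⟩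
  · intro μs μ hT
    refine tendsto_of_forall_isClosed_limsup_le' fun C hC => ?_
    have hint : ∀ F n (ν : ProbabilityMeasure ℝ), Integrable (fun x => (h F n x : ℝ)) (ν : Measure ℝ) := by
      intro F n ν
      refine Integrable.of_bound (C := 1) ?_ (ae_of_all _ fun x => ?_)
      · exact (NNReal.continuous_coe.comp (h F n).continuous).aestronglyMeasurable
      · rw [Real.norm_eq_abs, abs_of_nonneg (NNReal.coe_nonneg _)]
        exact NNReal.coe_le_one.2 (thickenedIndicator_le_one (hδ n) (CF F) x)
    have hlin : ∀ F n (ν : ProbabilityMeasure ℝ), ∫⁻ x, (h F n x : ENNReal) ∂(ν : Measure ℝ)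
        = ENNReal.ofReal (∫ x, (h F n x : ℝ) ∂(ν : Measure ℝ)) := by
      intro F n ν
      rw [ofReal_integral_eq_lintegral_ofReal (hint F n ν) (ae_of_all _ fun x => NNReal.coe_nonneg _)]
      simp
    have step1 : ∀ F n, limsup (fun i => (μs i : Measure ℝ) (CF F)) atTop ≤
        ∫⁻ x, (h F n x : ENNReal) ∂(μ : Measure ℝ) := by
      intro F n
      have : Tendsto (fun T => ∫⁻ x, (h F n x : ENNReal) ∂(μs T : Measure ℝ)) atTop
          (𝓝 (∫⁻ x, (h F n x : ENNReal) ∂(μ : Measure ℝ))) := by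
        simp_rw [hlin]
        exact (ENNReal.continuous_ofReal.tendsto _).comp (hT F n)
      rw [← this.limsup_eq]
      refine limsup_le_limsup (Eventually.of_forall fun T => ?_)
      simp only []
      rw [← lintegral_indicator_one (hCFcl F).measurableSet]
      refine lintegral_mono fun x => ?_
      by_cases hx : x ∈ CF F
      · simp only [Set.indicator_of_mem hx, Pi.one_apply]
        have := thickenedIndicator_one (hδ n) (CF F) hx
        simp only [h, this, ENNReal.coe_one, le_refl]
      · simp [Set.indicator_of_notMem hx]
    have step2 : ∀ F, limsup (fun i => (μs i : Measure ℝ) (CF F)) atTop ≤ (μ : Measure ℝ) (CF F) := by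
      intro F
      have := tendsto_lintegral_thickenedIndicator_of_isClosed (μ : Measure ℝ) (hCFcl F) hδ
        (tendsto_one_div_add_atTop_nhds_zero_nat)
      exact ge_of_tendsto' this (step1 F)
    classical
    let G : ℕ → Finset ℕ := fun k => (Finset.range k).filter (fun i => b i ⊆ Cᶜ)
    have hCG : ∀ k, C ⊆ CF (G k) := by
      intro k x hx
      simp only [CF, G, Set.mem_iInter, Finset.mem_filter, Set.mem_compl_iff]
      rintro i ⟨_, hi⟩ hxi
      exact hi hxi hx
    have hanti : Antitone fun k => CF (G k) := by
      intro k l hkl x hx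
      simp only [CF, G, Set.mem_iInter, Finset.mem_filter, Finset.mem_range] at hx ⊢
      exact fun i hi => hx i ⟨hi.1.trans_le hkl, hi.2⟩
    have hI : ⋂ k, CF (G k) = C := by
      apply Set.Subset.antisymm
      · intro x hx
        by_contra hxC
        obtain ⟨s, hs, hxs, hsC⟩ := hbasis.exists_subset_of_mem_open (show x ∈ Cᶜ from hxC) hC.isOpen_compl
        rw [hb] at hs
        obtain ⟨i, rfl⟩ := hs
        have := Set.mem_iInter.1 hx (i+1)
        simp only [CF, G, Set.mem_iInter, Finset.mem_filter, Finset.mem_range] at this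
        exact this i ⟨Nat.lt_succ_self i, hsC⟩ hxs
      · exact Set.subset_iInter hCG
    have hlim := tendsto_measure_iInter_atTop (μ := (μ : Measure ℝ)) (s := fun k => CF (G k))
      (fun k => (hCFcl _).measurableSet.nullMeasurableSet) hanti ⟨0, measure_ne_top _ _⟩
    rw [hI] at hlim
    refine ge_of_tendsto' hlim fun k => ?_
    refine le_trans (limsup_le_limsup (Eventually.of_forall fun T => ?_)) (step2 (G k))
    exact measure_mono (hCG k)


lemma exp_kernel_bound (γ : ℝ) (hγ : 0 < γ) :
    Integrable (fun v : ℝ => Real.exp (-γ * |v|)) ∧ ∫ v : ℝ, Real.exp (-γ * |v|) = 2 / γ := by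
  have h : ∫ v : ℝ, Real.exp (-γ * |v|) = 2 / γ := by
    rw [integral_comp_abs (f := fun x => Real.exp (-γ * x)), integral_exp_mul_Ioi (by linarith)]
    simp; ring
  refine ⟨?_, h⟩
  by_contra hn
  rw [integral_undef hn] at h
  have : 0 < 2 / γ := by positivity
  linarith

lemma second_moment {Ω : Type*} [MeasurableSpace Ω] (P : Measure Ω) [IsProbabilityMeasure P]
    (Y : ℝ → Ω → ℝ) (hY : Measurable (Function.uncurry Y)) (M : ℝ) (hM : ∀ u ω, |Y u ω| ≤ M)
    (C γ : ℝ) (hγ : 0 < γ)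
    (hcov : ∀ u v, 0 ≤ u → u ≤ v → |∫ ω, Y u ω * Y v ω ∂P| ≤ C * Real.exp (-γ * (v - u)))
    (S : ℝ) (hS : 0 ≤ S) :
    ∫ ω, (∫ u in (0:ℝ)..S, Y u ω) ^ 2 ∂P ≤ 2 * C / γ * S := by
  have hC : 0 ≤ C := by
    have := (abs_nonneg _).trans (hcov 0 0 le_rfl le_rfl)
    simpa using this
  set ν : Measure ℝ := volume.restrict (Set.Ioc 0 S) with hν
  have hcov' : ∀ u v, 0 < u → 0 < v → ∫ ω, Y u ω * Y v ω ∂P ≤ C * Real.exp (-γ * |u - v|) := by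
    intro u v hu hv
    rcases le_total u v with h | h
    · rw [abs_of_nonpos (by linarith)]
      have := (le_abs_self _).trans (hcov u v hu.le h)
      rwa [show -γ * -(u - v) = -γ * (v - u) by ring]
    · rw [abs_of_nonneg (by linarith)]
      have := (le_abs_self _).trans (hcov v u hv.le h)
      simpa only [mul_comm (Y u _)] using this
  have hmeas3 : Measurable (fun q : Ω × (ℝ × ℝ) => Y q.2.1 q.1 * Y q.2.2 q.1) := by
    have h1 : Measurable (fun q : Ω × (ℝ × ℝ) => Function.uncurry Y (q.2.1, q.1)) := hY.comp (by fun_prop)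
    have h2 : Measurable (fun q : Ω × (ℝ × ℝ) => Function.uncurry Y (q.2.2, q.1)) := hY.comp (by fun_prop)
    exact h1.mul h2
  have hint3 : Integrable (fun q : Ω × (ℝ × ℝ) => Y q.2.1 q.1 * Y q.2.2 q.1) (P.prod (ν.prod ν)) := by
    refine Integrable.of_bound (C := M * M) hmeas3.aestronglyMeasurable (ae_of_all _ fun q => ?_)
    rw [Real.norm_eq_abs, abs_mul]
    exact mul_le_mul (hM _ _) (hM _ _) (abs_nonneg _) ((abs_nonneg _).trans (hM 0 q.1))
  have hkint : Integrable (fun z : ℝ × ℝ => C * Real.exp (-γ * |z.1 - z.2|)) (ν.prod ν) := by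
    refine Integrable.of_bound (C := C) (by fun_prop) (ae_of_all _ fun z => ?_)
    rw [Real.norm_eq_abs, abs_mul, abs_of_nonneg hC, Real.abs_exp]
    refine mul_le_of_le_one_right hC (Real.exp_le_one_iff.2 ?_)
    have := abs_nonneg (z.1 - z.2)
    nlinarith
  calc ∫ ω, (∫ u in (0:ℝ)..S, Y u ω) ^ 2 ∂P
      = ∫ ω, ∫ z, Y z.1 ω * Y z.2 ω ∂(ν.prod ν) ∂P := by
        congr 1; ext ω
        rw [integral_prod_mul (fun u => Y u ω) (fun u => Y u ω), intervalIntegral.integral_of_le hS, sq]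
    _ = ∫ z, ∫ ω, Y z.1 ω * Y z.2 ω ∂P ∂(ν.prod ν) := by
        rw [integral_integral_swap hint3]
    _ ≤ ∫ z, C * Real.exp (-γ * |z.1 - z.2|) ∂(ν.prod ν) := by
        refine integral_mono_ae hint3.integral_prod_right hkint ?_
        have : ν.prod ν = (volume.prod volume).restrict (Set.Ioc 0 S ×ˢ Set.Ioc 0 S) := by
          rw [hν, Measure.prod_restrict]
        rw [this]
        filter_upwards [ae_restrict_mem (measurableSet_Ioc.prod measurableSet_Ioc)] with z hz
        exact hcov' _ _ hz.1.1 hz.2.1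
    _ = ∫ u, ∫ v, C * Real.exp (-γ * |u - v|) ∂ν ∂ν := by
        rw [integral_prod _ hkint]
    _ ≤ ∫ u, 2 * C / γ ∂ν := by
        refine integral_mono_ae hkint.integral_prod_left (integrable_const _) (ae_of_all _ fun u => ?_)
        have hK := exp_kernel_bound γ hγ
        have hi : Integrable (fun v : ℝ => Real.exp (-γ * |u - v|)) := by
          exact hK.1.comp_sub_left u
        have he : ∫ v : ℝ, Real.exp (-γ * |u - v|) = 2 / γ := by
          rw [← hK.2]
          exact integral_sub_left_eq_self (fun v => Real.exp (-γ * |v|)) volume u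
        calc ∫ v, C * Real.exp (-γ * |u - v|) ∂ν = C * ∫ v, Real.exp (-γ * |u - v|) ∂ν :=
              integral_const_mul _ _
          _ ≤ C * (2 / γ) := by
              refine mul_le_mul_of_nonneg_left ?_ hC
              rw [← he]
              exact setIntegral_le_integral hi (ae_of_all _ fun v => (Real.exp_pos _).le)
          _ = 2 * C / γ := by ring
    _ = 2 * C / γ * S := by
        rw [integral_const]
        simp [hν, Measure.real, hS, mul_comm]

lemma slln_cont {Ω : Type*} [MeasurableSpace Ω] (P : Measure Ω) [IsProbabilityMeasure P]
    (Y : ℝ → Ω → ℝ) (hY : Measurable (Function.uncurry Y)) (M : ℝ) (hM : ∀ u ω, |Y u ω| ≤ M)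
    (C γ : ℝ) (hγ : 0 < γ)
    (hcov : ∀ u v, 0 ≤ u → u ≤ v → |∫ ω, Y u ω * Y v ω ∂P| ≤ C * Real.exp (-γ * (v - u))) :
    ∀ᵐ ω ∂P, Tendsto (fun S : ℝ => (1 / S) * ∫ u in (0:ℝ)..S, Y u ω) atTop (𝓝 0) := by
  set K := 2 * C / γ with hK
  have hmeasI : ∀ S : ℝ, 0 ≤ S → StronglyMeasurable (fun ω => ∫ u in (0:ℝ)..S, Y u ω) := by
    intro S hS
    simp_rw [intervalIntegral.integral_of_le hS]
    exact StronglyMeasurable.integral_prod_right' (f := fun p : Ω × ℝ => Y p.2 p.1)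
      (hY.comp measurable_swap).stronglyMeasurable
  have hYint : ∀ ω a b, IntervalIntegrable (fun u => Y u ω) volume a b := by
    intro ω a b
    refine (intervalIntegrable_const (c := M)).mono_fun ?_ (ae_of_all _ fun u => ?_)
    · exact (hY.comp measurable_prodMk_right).aestronglyMeasurable
    · exact (hM u ω).trans (le_abs_self _)
  have hbd : ∀ ω a b, a ≤ b → |∫ u in a..b, Y u ω| ≤ M * (b - a) := by
    intro ω a b hab
    have := intervalIntegral.norm_integral_le_of_norm_le_const (a := a) (b := b) (C := M)
      (f := fun u => Y u ω) (fun u _ => hM u ω)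
    rwa [abs_of_nonneg (by linarith : 0 ≤ b - a)] at this
  let A : ℕ → Ω → ℝ := fun n ω => (1 / ((n:ℝ)+1)^2) * ∫ u in (0:ℝ)..((n:ℝ)+1)^2, Y u ω
  have hAm : ∀ n, Measurable (A n) := fun n => ((hmeasI _ (by positivity)).measurable).const_mul _
  have hAb : ∀ n ω, |A n ω| ≤ M := by
    intro n ω
    simp only [A, abs_mul]
    rw [abs_of_pos (by positivity : (0:ℝ) < 1 / ((n:ℝ)+1)^2), div_mul_eq_mul_div, one_mul,
      div_le_iff₀ (by positivity)]
    simpa using hbd ω 0 (((n:ℝ)+1)^2) (by positivity)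
  have hA2 : ∀ n, ∫ ω, A n ω ^ 2 ∂P ≤ K * (1 / ((n:ℝ)+1)^2) := by
    intro n
    have := second_moment P Y hY M hM C γ hγ hcov (((n:ℝ)+1)^2) (by positivity)
    simp only [A, mul_pow]
    rw [integral_const_mul]
    calc _ ≤ (1 / ((n:ℝ)+1)^2)^2 * (K * ((n:ℝ)+1)^2) := by gcongr
      _ = _ := by field_simp
  have hsum : Summable fun n : ℕ => K * (1 / ((n:ℝ)+1)^2) := by
    have h := (_root_.summable_nat_add_iff 1).2 (Real.summable_one_div_nat_pow.2 (one_lt_two))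
    refine Summable.mul_left _ (h.congr fun n => ?_)
    push_cast; rfl
  have hlt : ∫⁻ ω, ∑' n, ENNReal.ofReal (A n ω ^ 2) ∂P ≠ ⊤ := by
    rw [lintegral_tsum (fun n => ((hAm n).pow_const 2).ennreal_ofReal.aemeasurable)]
    refine ne_top_of_le_ne_top hsum.tsum_ofReal_ne_top (ENNReal.tsum_le_tsum fun n => ?_)
    rw [← ofReal_integral_eq_lintegral_ofReal _ (ae_of_all _ fun ω => sq_nonneg _)]
    · exact ENNReal.ofReal_le_ofReal (hA2 n)
    · refine Integrable.of_bound (C := M^2) ((hAm n).pow_const 2).aestronglyMeasurable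
        (ae_of_all _ fun ω => ?_)
      rw [Real.norm_eq_abs, abs_pow]
      exact pow_le_pow_left₀ (abs_nonneg _) (hAb n ω) 2
  have hae := ae_lt_top' (AEMeasurable.tsum
    (fun n => ((hAm n).pow_const 2).ennreal_ofReal.aemeasurable)) hlt
  filter_upwards [hae] with ω hω
  have ht := ENNReal.tendsto_atTop_zero_of_tsum_ne_top hω.ne
  have ht2 : Tendsto (fun n => |A n ω|) atTop (𝓝 0) := by
    have h1 := (ENNReal.tendsto_toReal ENNReal.zero_ne_top).comp ht
    have h2 : Tendsto (fun n => A n ω ^ 2) atTop (𝓝 0) := by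
      refine h1.congr fun n => ?_
      simp [ENNReal.toReal_ofReal (sq_nonneg (A n ω))]
    have h3 := (Real.continuous_sqrt.tendsto 0).comp h2
    simp only [Real.sqrt_zero] at h3
    refine h3.congr fun n => ?_
    simp [Real.sqrt_sq_eq_abs]
  have hM0 : 0 ≤ M := (abs_nonneg _).trans (hM 0 ω)
  let N : ℝ → ℕ := fun S => ⌊Real.sqrt S⌋₊ - 1
  have hN : Tendsto N atTop atTop := 
    (tendsto_sub_atTop_nat 1).comp (tendsto_nat_floor_atTop.comp Real.tendsto_sqrt_atTop)
  have hR : Tendsto (fun n : ℕ => M * (3 / ((n:ℝ)+1))) atTop (𝓝 0) := by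
    have := (tendsto_one_div_add_atTop_nhds_zero_nat (𝕜 := ℝ)).const_mul (M * 3)
    rw [mul_zero] at this
    refine this.congr fun n => by ring
  have hlim := (ht2.add hR).comp hN
  rw [add_zero] at hlim
  refine squeeze_zero_norm' ?_ hlim
  filter_upwards [eventually_ge_atTop 1] with S hS
  have hfl : 1 ≤ ⌊Real.sqrt S⌋₊ := by
    rw [Nat.one_le_floor_iff]; exact Real.one_le_sqrt.2 hS
  have hn1 : ((N S : ℕ):ℝ) + 1 = (⌊Real.sqrt S⌋₊ : ℝ) := by
    simp only [N]; rw [Nat.cast_sub hfl]; simp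
  set n := N S with hn
  have hlow : ((n:ℝ)+1)^2 ≤ S := by
    rw [hn1]
    calc _ ≤ (Real.sqrt S)^2 := by gcongr; exact Nat.floor_le (Real.sqrt_nonneg _)
      _ = S := Real.sq_sqrt (by linarith)
  have hup : S ≤ ((n:ℝ)+1+1)^2 := by
    rw [hn1]
    calc S = (Real.sqrt S)^2 := (Real.sq_sqrt (by linarith)).symm
      _ ≤ _ := by gcongr; exact (Nat.lt_floor_add_one _).le
  have hsplit : ∫ u in (0:ℝ)..S, Y u ω = (∫ u in (0:ℝ)..((n:ℝ)+1)^2, Y u ω) + ∫ u in ((n:ℝ)+1)^2..S, Y u ω :=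
    (intervalIntegral.integral_add_adjacent_intervals (hYint _ _ _) (hYint _ _ _)).symm
  have hp : (0:ℝ) < ((n:ℝ)+1)^2 := by positivity
  have hSp : 0 < S := by linarith
  have h1 : |∫ u in (0:ℝ)..((n:ℝ)+1)^2, Y u ω| = ((n:ℝ)+1)^2 * |A n ω| := by
    simp only [A, abs_mul]
    rw [abs_of_pos (by positivity : (0:ℝ) < 1 / ((n:ℝ)+1)^2)]
    field_simp
  have h2 : |∫ u in ((n:ℝ)+1)^2..S, Y u ω| ≤ M * (3 * ((n:ℝ)+1)) := by
    refine (hbd ω _ _ hlow).trans (mul_le_mul_of_nonneg_left ?_ hM0)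
    have : (0:ℝ) ≤ n := Nat.cast_nonneg n
    nlinarith
  rw [Real.norm_eq_abs, abs_mul, abs_of_pos (by positivity : 0 < 1 / S), div_mul_eq_mul_div, one_mul]
  simp only [Function.comp, ← hn]
  calc _ ≤ (((n:ℝ)+1)^2 * |A n ω| + M * (3 * ((n:ℝ)+1))) / S := by
        gcongr
        rw [hsplit, ← h1]
        exact (abs_add_le _ _).trans (by gcongr)
    _ ≤ (((n:ℝ)+1)^2 * |A n ω| + M * (3 * ((n:ℝ)+1))) / ((n:ℝ)+1)^2 := by
        gcongr
    _ = _ := by field_simp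


structure LevyHyp {Ω : Type*} [MeasurableSpace Ω] (P : Measure Ω) (V : ℝ → Ω → ℝ) (σ : ℝ≥0) : Prop where
  meas : ∀ t, Measurable (V t)
  zero : ∀ᵐ ω ∂P, V 0 ω = 0
  indep : ∀ (k : ℕ) (t : Fin (k + 1) → ℝ), Monotone t → 0 ≤ t 0 →
      iIndepFun
        (fun i : Fin k => fun ω => V (t i.succ) ω - V (t i.castSucc) ω) P
  stat : ∀ s t : ℝ, 0 ≤ s → s ≤ t →
      Measure.map (fun ω => V t ω - V s ω) P = Measure.map (V (t - s)) P
  L2 : MemLp (V 1) 2 P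
  cent : ∫ ω, V 1 ω ∂P = 0
  var : ∫ ω, (V 1 ω) ^ 2 ∂P = (σ : ℝ) ^ 2

lemma memLp_two_of_indep_add {Ω : Type*} [MeasurableSpace Ω] {P : Measure Ω} [IsProbabilityMeasure P]
    {X Y : Ω → ℝ} (hX : Measurable X) (hY : Measurable Y) (h : IndepFun X Y P)
    (hXY : MemLp (fun ω => X ω + Y ω) 2 P) : MemLp X 2 P := by
  have := Measure.isProbabilityMeasure_map (μ := P) hX.aemeasurable
  have := Measure.isProbabilityMeasure_map (μ := P) hY.aemeasurable
  have h1 : Integrable (fun ω => (X ω + Y ω)^2) P := hXY.integrable_sq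
  have h2 := (indepFun_iff_map_prod_eq_prod_map_map hX.aemeasurable hY.aemeasurable).1 h
  have h3 : Integrable (fun z : ℝ × ℝ => (z.1 + z.2)^2) ((P.map X).prod (P.map Y)) := by
    rw [← h2, integrable_map_measure (by fun_prop) (by fun_prop)]
    exact h1
  obtain ⟨y, hy⟩ := h3.prod_left_ae.exists
  have h4 : MemLp (fun x : ℝ => x + y) 2 (P.map X) :=
    (memLp_two_iff_integrable_sq (by fun_prop)).2 hy
  have h5 : MemLp (fun x : ℝ => x) 2 (P.map X) := by
    have := h4.sub (memLp_const y)
    refine this.congr_norm (by fun_prop) (ae_of_all _ fun x => by simp)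
  have := (memLp_map_measure_iff (by fun_prop) hX.aemeasurable).1 h5
  exact this

namespace LevyHyp
variable {Ω : Type*} [MeasurableSpace Ω] {P : Measure Ω} [IsProbabilityMeasure P]
  {V : ℝ → Ω → ℝ} {σ : ℝ≥0}

lemma indep2 (h : LevyHyp P V σ) {s t : ℝ} (hs : 0 ≤ s) (hst : s ≤ t) :
    IndepFun (V s) (fun ω => V t ω - V s ω) P := by
  have h1 := h.indep 2 ![0, s, t] (by
    intro i j hij
    fin_cases i <;> fin_cases j <;> simp_all <;> linarith) (by simp)
  have h2 := h1.indepFun (show (0 : Fin 2) ≠ 1 by decide)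
  refine h2.congr ?_ ?_
  · filter_upwards [h.zero] with ω hω
    simp [hω]
  · filter_upwards with ω
    simp

lemma ident (h : LevyHyp P V σ) {s t : ℝ} (hs : 0 ≤ s) (ht : 0 ≤ t) :
    IdentDistrib (fun ω => V (s + t) ω - V s ω) (V t) P P := by
  refine ⟨((h.meas _).sub (h.meas _)).aemeasurable, (h.meas _).aemeasurable, ?_⟩
  rw [h.stat s (s+t) hs (by linarith)]
  congr 2; ring

lemma memLp (h : LevyHyp P V σ) {t : ℝ} (ht : 0 ≤ t) : MemLp (V t) 2 P := by
  have key : ∀ n : ℕ, ∀ t : ℝ, 0 ≤ t → t ≤ n + 1 → MemLp (V t) 2 P := by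
    intro n
    induction n with
    | zero =>
      intro t ht h1
      simp only [CharP.cast_eq_zero, zero_add] at h1
      refine memLp_two_of_indep_add (h.meas _) ((h.meas 1).sub (h.meas t)) (h.indep2 ht h1) ?_
      simpa using h.L2
    | succ n ih =>
      intro t ht h1
      by_cases h2 : t ≤ n + 1
      · exact ih t ht h2
      · push Not at h2
        have hn : (0:ℝ) ≤ n := Nat.cast_nonneg n
        have a := ih (t - 1) (by linarith) (by push_cast at h1; linarith)
        have b := (h.ident (s := t - 1) (t := 1) (by linarith) (by norm_num)).memLp_iff.2 h.L2
        have := a.add b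
        refine this.congr_norm (h.meas _).aestronglyMeasurable (ae_of_all _ fun x => by simp)
  obtain ⟨n, hn⟩ := exists_nat_ge t
  exact key n t ht (by linarith)

lemma integrable (h : LevyHyp P V σ) {t : ℝ} (ht : 0 ≤ t) : Integrable (V t) P :=
  (h.memLp ht).integrable one_le_two

lemma mean_add (h : LevyHyp P V σ) {s t : ℝ} (hs : 0 ≤ s) (ht : 0 ≤ t) :
    ∫ ω, V (s + t) ω ∂P = ∫ ω, V s ω ∂P + ∫ ω, V t ω ∂P := by
  rw [← (h.ident hs ht).integral_eq, integral_sub (h.integrable (by linarith)) (h.integrable hs)]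
  ring

lemma var_add (h : LevyHyp P V σ) {s t : ℝ} (hs : 0 ≤ s) (ht : 0 ≤ t) :
    Var[V (s + t); P] = Var[V s; P] + Var[V t; P] := by
  rw [← (h.ident hs ht).variance_eq]
  have hi := (h.ident hs ht).memLp_iff.2 (h.memLp ht)
  rw [← IndepFun.variance_add (h.memLp hs) hi (h.indep2 hs (by linarith))]
  congr 1
  ext ω; simp

lemma mean_mul (h : LevyHyp P V σ) {t : ℝ} (ht : 0 ≤ t) (n : ℕ) :
    ∫ ω, V (n * t) ω ∂P = n * ∫ ω, V t ω ∂P := by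
  induction n with
  | zero =>
    simp only [CharP.cast_eq_zero, zero_mul]
    rw [integral_eq_zero_of_ae]
    exact h.zero
  | succ n ih =>
    push_cast
    rw [add_mul, one_mul, h.mean_add (by positivity) ht, ih]; ring

lemma var_nat (h : LevyHyp P V σ) (n : ℕ) : Var[V n; P] = n * σ ^ 2 := by
  induction n with
  | zero =>
    simp only [CharP.cast_eq_zero, zero_mul]
    rw [variance_congr (Y := 0) h.zero]
    exact variance_zero _
  | succ n ih =>
    push_cast
    rw [h.var_add (by positivity) zero_le_one, ih, variance_of_integral_eq_zero (h.meas 1).aemeasurable h.cent, h.var]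
    ring

lemma var_le (h : LevyHyp P V σ) {t : ℝ} (ht : 0 ≤ t) : Var[V t; P] ≤ (t + 1) * σ ^ 2 := by
  have h1 : ((⌈t⌉₊ : ℕ) : ℝ) = t + (⌈t⌉₊ - t) := by ring
  have h2 := h.var_nat ⌈t⌉₊
  rw [h1, h.var_add ht (by linarith [Nat.le_ceil t]), ← h1] at h2
  have h3 := variance_nonneg (V (⌈t⌉₊ - t)) P
  have h4 : ((⌈t⌉₊ : ℕ) : ℝ) ≤ t + 1 := (Nat.ceil_lt_add_one ht).le
  nlinarith [sq_nonneg (σ : ℝ)]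

lemma abs_le (h : LevyHyp P V σ) (hm : ∀ t, 0 ≤ t → ∫ ω, V t ω ∂P = 0) {t : ℝ} (ht : 0 ≤ t) :
    ∫ ω, |V t ω| ∂P ≤ σ * √(t + 1) := by
  have h1 := h.var_le ht
  rw [variance_of_integral_eq_zero (h.meas t).aemeasurable (hm t ht)] at h1
  have h2 := variance_nonneg (fun ω => |V t ω|) P
  have h3 : MemLp (fun ω => |V t ω|) 2 P := (h.memLp ht).abs
  rw [variance_eq_sub h3] at h2
  simp only [Pi.pow_apply, sq_abs] at h2
  refine abs_le_of_sq_le_sq' ?_ (by positivity) |>.2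
  rw [mul_pow, Real.sq_sqrt (by linarith)]
  linarith

lemma rat_mean (h : LevyHyp P V σ) (p q : ℕ) (hq : 0 < q) : ∫ ω, V (p / q) ω ∂P = 0 := by
  have h1 := h.mean_mul (t := p / q) (by positivity) q
  have h2 := h.mean_mul (t := 1) zero_le_one p
  rw [mul_div_cancel₀ _ (by positivity)] at h1
  rw [mul_one, h.cent, mul_zero, h1] at h2
  rcases mul_eq_zero.1 h2 with h3 | h3
  · exact absurd h3 (by positivity)
  · exact h3

lemma mean_zero_of_bdd (h : LevyHyp P V σ) (δ C : ℝ) (hδ : 0 < δ)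
    (hC : ∀ x, 0 ≤ x → x < δ → |∫ ω, V x ω ∂P| ≤ C) : ∀ t, 0 ≤ t → ∫ ω, V t ω ∂P = 0 := by
  obtain ⟨q, hq⟩ := exists_nat_one_div_lt hδ
  -- every value is bounded by C
  have hall : ∀ t, 0 ≤ t → |∫ ω, V t ω ∂P| ≤ C := by
    intro t ht
    have hq0 : (0:ℝ) < (q:ℝ)+1 := by positivity
    set p := ⌊t * ((q:ℝ)+1)⌋₊ with hp
    have hp1 : (p:ℝ) ≤ t * (q+1) := Nat.floor_le (by positivity)
    have hp2 : t * (q+1) < p + 1 := Nat.lt_floor_add_one _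
    have e1 : (p:ℝ) / ((q+1 : ℕ):ℝ) ≤ t := by
      push_cast; rw [div_le_iff₀ hq0]; exact hp1
    have e2 : t - (p:ℝ) / ((q+1 : ℕ):ℝ) < δ := by
      refine lt_trans ?_ hq
      push_cast
      rw [sub_lt_iff_lt_add, ← add_div, lt_div_iff₀ hq0]; linarith
    have h3 := h.mean_add (s := (p:ℝ) / ((q+1 : ℕ):ℝ)) (t := t - (p:ℝ) / ((q+1 : ℕ):ℝ)) (by positivity) (by linarith)
    rw [h.rat_mean p (q+1) (by omega), zero_add, add_sub_cancel] at h3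
    rw [h3]
    exact hC _ (by linarith) e2
  intro t ht
  by_contra hne
  have hpos : 0 < |∫ ω, V t ω ∂P| := abs_pos.2 hne
  obtain ⟨n, hn⟩ := exists_nat_gt (C / |∫ ω, V t ω ∂P|)
  have h1 := hall (n * t) (by positivity)
  rw [h.mean_mul ht n, abs_mul, Nat.abs_cast] at h1
  rw [div_lt_iff₀ hpos] at hn
  linarith

end LevyHyp


lemma steinhaus_bdd (m f : ℝ → ℝ) (hf_pos : ∀ x, 1 ≤ x → 0 < f x) (β : ℝ) (hβ : 0 < β)
    (hB : ∀ x y : ℝ, 1 ≤ x → x ≤ y → f x / x ^ β ≤ f y / y ^ β)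
    (hm : Measurable fun t => m (f t))
    (hsub : ∀ x y, 0 ≤ x → x ≤ y → m (y - x) = m y - m x) :
    ∃ δ > 0, ∃ C, ∀ x, 0 ≤ x → x < δ → |m x| ≤ C := by
  have hpow : ∀ x y : ℝ, 1 ≤ x → x ≤ y → y ≤ 2 → β / 2 * (y - x) ≤ y ^ β - x ^ β := by
    intro x y hx hxy hy
    refine Convex.mul_sub_le_image_sub_of_le_deriv (convex_Icc 1 2) (f := fun z : ℝ => z ^ β)
      ?_ ?_ ?_ x ⟨hx, hxy.trans hy⟩ y ⟨hx.trans hxy, hy⟩ hxy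
    · exact (Real.continuous_rpow_const hβ.le).continuousOn
    · intro z hz
      rw [interior_Icc] at hz
      exact (Real.differentiableAt_rpow_const_of_ne β (by linarith [hz.1])).differentiableWithinAt
    · intro z hz
      rw [interior_Icc] at hz
      have hz0 : 0 < z := by linarith [hz.1]
      rw [Real.deriv_rpow_const]
      have : (1:ℝ)/2 ≤ z ^ (β - 1) := by
        calc (1:ℝ)/2 ≤ 1 / z := one_div_le_one_div_of_le hz0 hz.2.le
          _ = z ^ (-1 : ℝ) := by rw [Real.rpow_neg_one]; simp
          _ ≤ _ := Real.rpow_le_rpow_of_exponent_le hz.1.le (by linarith)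
      nlinarith
  have hexp : ∀ x y : ℝ, 1 ≤ x → x ≤ y → y ≤ 2 → f 1 * (β / 2) * (y - x) ≤ f y - f x := by
    intro x y hx hxy hy
    have hx0 : 0 < x ^ β := Real.rpow_pos_of_pos (by linarith) _
    have hy0 : 0 < y ^ β := Real.rpow_pos_of_pos (by linarith) _
    have h1 := hB 1 x le_rfl hx
    have h2 := hB x y hx hxy
    simp only [Real.one_rpow, div_one] at h1
    have h3 := hpow x y hx hxy hy
    have h4 : f x = f x / x ^ β * x ^ β := by field_simp
    rw [le_div_iff₀ hy0] at h2
    have h5 : 0 ≤ β / 2 * (y - x) := mul_nonneg (by linarith) (by linarith)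
    have h6 : 0 < f 1 := hf_pos 1 le_rfl
    calc f 1 * (β / 2) * (y - x) = f 1 * (β / 2 * (y - x)) := by ring
      _ ≤ f x / x ^ β * (y ^ β - x ^ β) := by
          apply mul_le_mul h1 h3 h5 (by linarith)
      _ = f x / x ^ β * y ^ β - f x := by rw [mul_sub, ← h4]
      _ ≤ _ := by linarith
  have hc : 0 < f 1 * (β / 2) := mul_pos (hf_pos 1 le_rfl) (by linarith)
  set c := f 1 * (β / 2)
  let E : ℕ → Set ℝ := fun n => Set.Icc 1 2 ∩ {t | |m (f t)| ≤ n}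
  have hE : ∀ n, MeasurableSet (E n) := fun n =>
    measurableSet_Icc.inter (measurableSet_le hm.abs measurable_const)
  obtain ⟨n, hn⟩ : ∃ n, 0 < volume (E n) := by
    apply exists_measure_pos_of_not_measure_iUnion_null
    have : ⋃ n, E n = Set.Icc 1 2 := by
      ext t
      simp only [E, Set.mem_iUnion, Set.mem_inter_iff, Set.mem_ofPred_eq, exists_and_left, and_iff_left_iff_imp]
      exact fun _ => exists_nat_ge _
    rw [this]; simp
  have hmono : MonotoneOn f (E n) := by
    intro x hx y hy hxy
    have := hexp x y hx.1.1 hxy hy.1.2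
    nlinarith
  have hinj : Set.InjOn f (E n) := by
    have : ∀ x ∈ E n, ∀ y ∈ E n, x < y → f x ≠ f y := by
      intro x hx y hy hxy he
      have := hexp x y hx.1.1 hxy.le hy.1.2
      nlinarith
    intro x hx y hy he
    rcases lt_trichotomy x y with h | h | h
    · exact absurd he (this x hx y hy h)
    · exact h
    · exact absurd he.symm (this y hy x hx h)
  have hmeas := (hE n).image_of_monotoneOn hmono
  have hpos : 0 < volume (f '' E n) := by
    rw [pos_iff_ne_zero]
    intro h0
    have hinv := hinj.leftInvOn_invFunOn
    have him : Function.invFunOn f (E n) '' (f '' E n) = E n := hinv.image_image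
    have hlip : LipschitzOnWith (Real.toNNReal (1 / c)) (Function.invFunOn f (E n)) (f '' E n) := by
      refine LipschitzOnWith.of_dist_le_mul ?_
      rintro _ ⟨x, hx, rfl⟩ _ ⟨y, hy, rfl⟩
      rw [hinv hx, hinv hy, Real.coe_toNNReal _ (by positivity), Real.dist_eq, Real.dist_eq,
        div_mul_eq_mul_div, one_mul, le_div_iff₀ hc]
      rcases le_total x y with h | h
      · have := hexp x y hx.1.1 h hy.1.2
        rw [abs_of_nonpos (by linarith), abs_of_nonpos (by nlinarith)]
        linarith
      · have := hexp y x hy.1.1 h hx.1.2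
        rw [abs_of_nonneg (by linarith), abs_of_nonneg (by nlinarith)]
        linarith
    have := hlip.hausdorffMeasure_image_le (d := 1) zero_le_one
    rw [him, hausdorffMeasure_real, h0, mul_zero] at this
    exact hn.ne' (le_antisymm this bot_le)
  have hst := Measure.sub_mem_nhds_zero_of_addHaar_pos volume (f '' E n) hmeas hpos
  obtain ⟨δ, hδ, hball⟩ := Metric.mem_nhds_iff.1 hst
  refine ⟨δ, hδ, n + n, fun x hx hxδ => ?_⟩
  have : x ∈ Metric.ball (0:ℝ) δ := by simp [abs_of_nonneg hx, hxδ]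
  obtain ⟨_, ⟨y, hy, rfl⟩, _, ⟨z, hz, rfl⟩, he⟩ := Set.mem_sub.1 (hball this)
  rw [← he, hsub _ _ (hf_pos z hz.1.1).le (by linarith)]
  exact (abs_sub _ _).trans (add_le_add hy.2 hz.2)

namespace LevyHyp
variable {Ω : Type*} [MeasurableSpace Ω] {P : Measure Ω} [IsProbabilityMeasure P]
  {V : ℝ → Ω → ℝ} {σ : ℝ≥0}

lemma mean_zero (h : LevyHyp P V σ) (f : ℝ → ℝ) (hf_pos : ∀ x, 1 ≤ x → 0 < f x)
    (β : ℝ) (hβ : 0 < β)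
    (hB : ∀ x y : ℝ, 1 ≤ x → x ≤ y → f x / x ^ β ≤ f y / y ^ β)
    (hjoint : Measurable (Function.uncurry fun (t : ℝ) (ω : Ω) => V (f t) ω)) :
    ∀ t, 0 ≤ t → ∫ ω, V t ω ∂P = 0 := by
  obtain ⟨δ, hδ, C, hC⟩ := steinhaus_bdd (fun t => ∫ ω, V t ω ∂P) f hf_pos β hβ hB
    (hjoint.stronglyMeasurable.integral_prod_right (ν := P)).measurable
    (by
      intro x y hx hxy
      have := h.mean_add hx (show 0 ≤ y - x by linarith)
      rw [add_sub_cancel] at this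
      linarith)
  exact h.mean_zero_of_bdd δ C hδ hC

lemma clt_nat (h : LevyHyp P V σ) (g : ℝ → ℝ) (M : ℝ) (hM : ∀ x, |g x| ≤ M) (L : ℝ≥0)
    (hg : LipschitzWith L g) :
    Tendsto (fun n : ℕ => ∫ ω, g (V n ω / √n) ∂P) atTop (𝓝 (∫ y, g y ∂(gaussianReal 0 (σ ^ 2)))) := by
  let X : ℕ → Ω → ℝ := fun k ω => V (k + 1) ω - V k ω
  have hXm : ∀ k, Measurable (X k) := fun k => (h.meas _).sub (h.meas _)
  have hid : ∀ i, IdentDistrib (X i) (V 1) P P := fun i => h.ident (Nat.cast_nonneg i) zero_le_one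
  have hind : iIndepFun X P := by
    rw [iIndepFun_iff_finset]
    intro s
    obtain ⟨k, hk⟩ := s.exists_nat_subset_range
    have h1 := h.indep k (fun i => (i : ℕ)) (fun i j hij => by simpa using hij) (by simp)
    have h2 := h1.precomp (g := fun i : s => (⟨i, Finset.mem_range.1 (hk i.2)⟩ : Fin k))
      (by
        intro a b hab
        exact Subtype.ext (Fin.mk.inj_iff.1 hab))
    convert h2 using 2 with i
    ext ω
    simp [X]
  have hvar : Var[X 0; P] = σ ^ 2 := by
    rw [(hid 0).variance_eq, variance_of_integral_eq_zero (h.meas 1).aemeasurable h.cent, h.var]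
  have hmean : P[X 0] = 0 := by rw [(hid 0).integral_eq, h.cent]
  have hclt := tendstoInDistribution_inv_sqrt_mul_sum_sub (P := P) (X := X)
    (Y := (id : ℝ → ℝ)) (P' := gaussianReal 0 (σ ^ 2))
    (by
      have : Var[X 0; P].toNNReal = σ ^ 2 := by
        rw [hvar]; ext; simp
      rw [this]; exact HasLaw.id) ((hid 0).memLp_iff.2 h.L2) hind (fun i => (hid i).trans (hid 0).symm)
  have h3 := tendsto_iff_forall_lipschitz_integral_tendsto.1 hclt.tendsto g
    ⟨M + M, fun x y => by
      rw [Real.dist_eq]; exact (abs_sub _ _).trans (add_le_add (hM _) (hM _))⟩ ⟨L, hg⟩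
  simp only [ProbabilityMeasure.coe_mk, Measure.map_id] at h3
  refine h3.congr fun n => ?_
  rw [integral_map (by fun_prop) hg.continuous.aestronglyMeasurable]
  refine integral_congr_ae ?_
  filter_upwards [h.zero] with ω hω
  have : ∑ k ∈ Finset.range n, X k ω = V n ω := by
    have := Finset.sum_range_sub (fun k : ℕ => V k ω) n
    simp only [Nat.cast_add, Nat.cast_one, Nat.cast_zero, hω, sub_zero] at this
    exact this
  rw [this, hmean]
  congr 1
  ring

lemma G_integrable (_h : LevyHyp P V σ) (g : ℝ → ℝ) (M : ℝ) (hM : ∀ x, |g x| ≤ M) (hg : Continuous g)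
    (X : Ω → ℝ) (hX : Measurable X) : Integrable (fun ω => g (X ω)) P :=
  Integrable.of_bound (C := M) (hg.measurable.comp hX).aestronglyMeasurable (ae_of_all _ fun _ => hM _)

lemma clt (h : LevyHyp P V σ) (hm : ∀ t, 0 ≤ t → ∫ ω, V t ω ∂P = 0)
    (g : ℝ → ℝ) (M : ℝ) (hM : ∀ x, |g x| ≤ M) (L : ℝ≥0)
    (hg : LipschitzWith L g) :
    Tendsto (fun s : ℝ => ∫ ω, g (V s ω / √s) ∂P) atTop (𝓝 (∫ y, g y ∂(gaussianReal 0 (σ ^ 2)))) := by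
  have h1 := (h.clt_nat g M hM L hg).comp (tendsto_nat_floor_atTop (α := ℝ))
  have h2 : Tendsto (fun s : ℝ => ∫ ω, g (V s ω / √s) ∂P - ∫ ω, g (V (⌊s⌋₊ : ℕ) ω / √(⌊s⌋₊ : ℕ)) ∂P) atTop (𝓝 0) := by
    have h3 : Tendsto (fun s : ℝ => 4 * L * σ * (√s)⁻¹) atTop (𝓝 0) := by
      have := (tendsto_inv_atTop_zero.comp Real.tendsto_sqrt_atTop).const_mul (4 * (L:ℝ) * σ)
      rwa [mul_zero] at this
    refine squeeze_zero_norm' ?_ h3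
    filter_upwards [eventually_ge_atTop 1] with s hs
    set n := ⌊s⌋₊
    have hn1 : (1:ℝ) ≤ n := by exact_mod_cast (Nat.one_le_floor_iff s).2 hs
    have hn2 : (n:ℝ) ≤ s := Nat.floor_le (by linarith)
    have hn3 : s < n + 1 := Nat.lt_floor_add_one s
    have hsn : 0 < √(n:ℝ) := Real.sqrt_pos.2 (by linarith)
    have hss : 0 < √s := Real.sqrt_pos.2 (by linarith)
    have hns : √(n:ℝ) ≤ √s := Real.sqrt_le_sqrt hn2
    have hsq : √s ≤ √(n:ℝ) + 1 / √(n:ℝ) := by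
      rw [Real.sqrt_le_left (by positivity), add_sq, Real.sq_sqrt (by linarith)]
      have : 2 * √(n:ℝ) * (1 / √(n:ℝ)) = 2 := by field_simp
      rw [this]
      have := sq_nonneg (1 / √(n:ℝ))
      linarith
    have hdiff : 1 / √(n:ℝ) - 1 / √s ≤ 1 / (n * √s) := by
      rw [div_sub_div _ _ hsn.ne' hss.ne', div_le_div_iff₀ (by positivity) (by positivity)]
      have e1 : (√s - √(n:ℝ)) * √(n:ℝ) ≤ 1 := by
        have := mul_le_mul_of_nonneg_right hsq hsn.le
        rw [add_mul, div_mul_cancel₀ _ hsn.ne'] at this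
        linarith
      have e2 : (n:ℝ) = √(n:ℝ) * √(n:ℝ) := (Real.mul_self_sqrt (by linarith)).symm
      have e3 : (√s - √(n:ℝ)) * n = ((√s - √(n:ℝ)) * √(n:ℝ)) * √(n:ℝ) := by
        rw [mul_assoc, ← e2]
      calc _ = ((√s - √(n:ℝ)) * n) * √s := by ring
        _ = ((√s - √(n:ℝ)) * √(n:ℝ)) * (√(n:ℝ) * √s) := by rw [e3]; ring
        _ ≤ 1 * (√(n:ℝ) * √s) := by gcongr
        _ = _ := by ring
    have hdiff0 : 0 ≤ 1 / √(n:ℝ) - 1 / √s := by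
      rw [sub_nonneg]; exact one_div_le_one_div_of_le hsn hns
    have hi1 := h.integrable (show (0:ℝ) ≤ s by linarith)
    have hi2 := h.integrable (show (0:ℝ) ≤ n by linarith)
    have hb1 := h.abs_le hm (show (0:ℝ) ≤ s - n by linarith)
    have hb2 := h.abs_le hm (show (0:ℝ) ≤ n by linarith)
    have hid := (h.ident (s := n) (t := s - n) (by linarith) (by linarith)).comp measurable_abs
    have hie := hid.integral_eq
    simp only [Function.comp_def, add_sub_cancel] at hie
    rw [← integral_sub (h.G_integrable g M hM hg.continuous _ ((h.meas s).div_const _))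
      (h.G_integrable g M hM hg.continuous _ ((h.meas n).div_const _))]
    have hpt : ∀ ω, ‖g (V s ω / √s) - g (V n ω / √n)‖ ≤
        L * (1 / √s * |V s ω - V n ω| + (1 / √n - 1 / √s) * |V n ω|) := by
      intro ω
      refine (hg.dist_le_mul (V s ω / √s) (V n ω / √n)).trans ?_
      refine mul_le_mul_of_nonneg_left ?_ L.2
      rw [Real.dist_eq]
      have : V s ω / √s - V n ω / √n = 1 / √s * (V s ω - V n ω) + -((1 / √n - 1 / √s) * V n ω) := by ring
      rw [this]
      refine (abs_add_le _ _).trans ?_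
      rw [abs_neg, abs_mul, abs_mul, abs_of_nonneg hdiff0, abs_of_nonneg (by positivity : 0 ≤ 1 / √s)]
    have hia : Integrable (fun ω => 1 / √s * |V s ω - V n ω|) P := (hi1.sub hi2).abs.const_mul _
    have hib : Integrable (fun ω => (1 / √n - 1 / √s) * |V n ω|) P := hi2.abs.const_mul _
    have hq1 : √(s - n + 1) ≤ 2 := by
      rw [Real.sqrt_le_left (by norm_num)]; linarith
    have hq2 : √((n:ℝ) + 1) ≤ 2 * n := by
      rw [Real.sqrt_le_left (by positivity)]; nlinarith
    calc _ ≤ ∫ ω, L * (1 / √s * |V s ω - V n ω| + (1 / √n - 1 / √s) * |V n ω|) ∂P :=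
          norm_integral_le_of_norm_le ((hia.add hib).const_mul _) (ae_of_all _ hpt)
      _ = L * (1 / √s * ∫ ω, |V (s - n) ω| ∂P + (1 / √n - 1 / √s) * ∫ ω, |V n ω| ∂P) := by
          rw [integral_const_mul, integral_add hia hib, integral_const_mul, integral_const_mul, hie]
      _ ≤ L * (1 / √s * (σ * 2) + 1 / (n * √s) * (σ * (2 * n))) := by
          have : (0:ℝ) ≤ σ := σ.2
          have : (0:ℝ) ≤ L := L.2
          gcongr
          · exact hb1.trans (by gcongr)
          · exact hb2.trans (by gcongr)
      _ = _ := by field_simp; ring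
  have := h2.add h1
  rw [zero_add] at this
  refine this.congr fun s => ?_
  simp

lemma cov_bound (h : LevyHyp P V σ) (hm : ∀ t, 0 ≤ t → ∫ ω, V t ω ∂P = 0)
    (g : ℝ → ℝ) (M : ℝ) (hM : ∀ x, |g x| ≤ M) (L : ℝ≥0)
    (hg : LipschitzWith L g) (a b : ℝ) (ha : 0 < a) (hab : a ≤ b) :
    |∫ ω, (g (V a ω / √a) - ∫ ω', g (V a ω' / √a) ∂P) * (g (V b ω / √b) - ∫ ω', g (V b ω' / √b) ∂P) ∂P|
      ≤ 2 * M * L * σ * (√(a + 1) / √b) := by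
  have hb : 0 < b := ha.trans_le hab
  set U : Ω → ℝ := fun ω => g (V a ω / √a) - ∫ ω', g (V a ω' / √a) ∂P with hU
  set W : Ω → ℝ := fun ω => g ((V b ω - V a ω) / √b) with hW
  set c := ∫ ω', g (V b ω' / √b) ∂P with hc
  have hI : ∀ X : Ω → ℝ, Measurable X → Integrable (fun ω => g (X ω)) P :=
    fun X hX => h.G_integrable g M hM hg.continuous X hX
  have hgm := hg.continuous.measurable
  have hUm : Measurable U := (hgm.comp ((h.meas a).div_const _)).sub_const _
  have hUint : Integrable U P := (hI _ ((h.meas a).div_const _)).sub (integrable_const _)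
  have hU0 : ∫ ω, U ω ∂P = 0 := by
    rw [hU, integral_sub (hI _ ((h.meas a).div_const _)) (integrable_const _)]; simp
  have hMc : |∫ ω', g (V a ω' / √a) ∂P| ≤ M := by
    have := norm_integral_le_of_norm_le_const (μ := P) (C := M) (f := fun ω' => g (V a ω' / √a)) (ae_of_all _ fun _ => hM _)
    simpa using this
  have hUb : ∀ ω, |U ω| ≤ 2 * M := by
    intro ω
    refine (abs_sub _ _).trans ?_
    linarith [hM (V a ω / √a)]
  have hWint : Integrable W P := hI _ (((h.meas b).sub (h.meas a)).div_const _)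
  have hUW : ∫ ω, U ω * W ω ∂P = 0 := by
    have hi := (h.indep2 ha.le hab).comp (φ := fun x => g (x / √a) - ∫ ω', g (V a ω' / √a) ∂P)
      (ψ := fun x => g (x / √b)) (by fun_prop) (by fun_prop)
    have := hi.integral_fun_mul_eq_mul_integral hUint.aestronglyMeasurable hWint.aestronglyMeasurable
    have e : ∫ ω, U ω * W ω ∂P = (∫ ω, U ω ∂P) * ∫ ω, W ω ∂P := this
    rw [e, hU0, zero_mul]
  have hDint : Integrable (fun ω => U ω * (g (V b ω / √b) - W ω)) P := by
    refine ((hI _ ((h.meas b).div_const _)).sub hWint).bdd_mul (c := 2 * M) hUm.aestronglyMeasurable (ae_of_all _ hUb)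
  have hUWint : Integrable (fun ω => U ω * W ω) P :=
    hWint.bdd_mul (c := 2 * M) hUm.aestronglyMeasurable (ae_of_all _ hUb)
  have hrew : ∫ ω, U ω * (g (V b ω / √b) - c) ∂P = ∫ ω, U ω * (g (V b ω / √b) - W ω) ∂P := by
    have : ∀ ω, U ω * (g (V b ω / √b) - c) = U ω * (g (V b ω / √b) - W ω) + U ω * W ω - U ω * c := by
      intro ω; ring
    simp_rw [this]
    have hadd : Integrable (fun ω => U ω * (g (V b ω / √b) - W ω) + U ω * W ω) P := hDint.add hUWint
    rw [integral_sub hadd (hUint.mul_const _), integral_add hDint hUWint, hUW,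
      integral_mul_const, hU0]
    ring
  rw [hrew]
  have hM0 : 0 ≤ M := (abs_nonneg _).trans hMc
  have hL0 : (0:ℝ) ≤ L := L.2
  have hpt : ∀ ω, ‖U ω * (g (V b ω / √b) - W ω)‖ ≤ 2 * M * L / √b * |V a ω| := by
    intro ω
    rw [norm_mul]
    have h1 : ‖g (V b ω / √b) - W ω‖ ≤ L * (|V a ω| / √b) := by
      refine (hg.dist_le_mul _ _).trans (le_of_eq ?_)
      rw [Real.dist_eq, ← _root_.sub_div, sub_sub_cancel, abs_div, abs_of_nonneg (Real.sqrt_nonneg b)]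
    calc _ ≤ 2 * M * (L * (|V a ω| / √b)) := mul_le_mul (hUb ω) h1 (norm_nonneg _) (by positivity)
      _ = _ := by ring
  calc _ ≤ ∫ ω, 2 * M * L / √b * |V a ω| ∂P :=
        norm_integral_le_of_norm_le ((h.integrable ha.le).abs.const_mul _) (ae_of_all _ hpt)
    _ = 2 * M * L / √b * ∫ ω, |V a ω| ∂P := integral_const_mul _ _
    _ ≤ 2 * M * L / √b * (σ * √(a + 1)) := by
        have := h.abs_le hm ha.le
        gcongr
    _ = _ := by ring

end LevyHyp


lemma cesaro_int (h : ℝ → ℝ) (hm : Measurable h) (M ℓ : ℝ) (hM : ∀ u, |h u| ≤ M)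
    (hl : Tendsto h atTop (𝓝 ℓ)) :
    Tendsto (fun S : ℝ => (1 / S) * ∫ u in (0:ℝ)..S, h u) atTop (𝓝 ℓ) := by
  have h1 : Tendsto (fun S : ℝ => ∫ x in (0:ℝ)..1, h (S * x)) atTop (𝓝 (∫ x in (0:ℝ)..1, ℓ)) := by
    refine intervalIntegral.tendsto_integral_filter_of_dominated_convergence (fun _ => M) ?_ ?_ ?_ ?_
    · exact Eventually.of_forall fun S => (hm.comp (measurable_const_mul S)).aestronglyMeasurable
    · exact Eventually.of_forall fun S => ae_of_all _ fun x _ => hM _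
    · exact intervalIntegrable_const
    · refine ae_of_all _ fun x hx => ?_
      rw [Set.uIoc_of_le zero_le_one] at hx
      exact hl.comp (tendsto_id.atTop_mul_const hx.1)
  simp only [intervalIntegral.integral_const, sub_zero, one_smul] at h1
  refine h1.congr' ?_
  filter_upwards [eventually_gt_atTop 0] with S hS
  rw [intervalIntegral.integral_comp_mul_left _ hS.ne']
  simp

theorem stmt11
    {Ω : Type*} [MeasurableSpace Ω] (P : Measure Ω) [IsProbabilityMeasure P]
    (V : ℝ → Ω → ℝ) (σ : ℝ≥0)
    (hVmeas : ∀ t, Measurable (V t))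
    (hV0 : ∀ᵐ ω ∂P, V 0 ω = 0)
    (hindep : ∀ (k : ℕ) (t : Fin (k + 1) → ℝ), Monotone t → 0 ≤ t 0 →
      iIndepFun
        (fun i : Fin k => fun ω => V (t i.succ) ω - V (t i.castSucc) ω) P)
    (hstat : ∀ s t : ℝ, 0 ≤ s → s ≤ t →
      Measure.map (fun ω => V t ω - V s ω) P = Measure.map (V (t - s)) P)
    (hL2 : MemLp (V 1) 2 P)
    (hcent : ∫ ω, V 1 ω ∂P = 0)
    (hvar : ∫ ω, (V 1 ω) ^ 2 ∂P = (σ : ℝ) ^ 2)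
    (f : ℝ → ℝ) (hf_pos : ∀ x, 1 ≤ x → 0 < f x)
    (β : ℝ) (hβ : 0 < β)
    (hB : ∀ x y : ℝ, 1 ≤ x → x ≤ y → f x / x ^ β ≤ f y / y ^ β)
    (hjoint : Measurable (Function.uncurry fun (t : ℝ) (ω : Ω) => V (f t) ω)) :
    ∀ᵐ ω ∂P, ∀ g : BoundedContinuousFunction ℝ ℝ,
      Tendsto (fun T : ℝ =>
          (1 / Real.log T) *
            ∫ t in (1 : ℝ)..T, g (V (f t) ω / Real.sqrt (f t)) * (1 / t)) atTop
        (𝓝 (∫ y, g y ∂(gaussianReal 0 (σ ^ 2)))) := by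
  have h : LevyHyp P V σ := ⟨hVmeas, hV0, hindep, hstat, hL2, hcent, hvar⟩
  have hm := h.mean_zero f hf_pos β hβ hB hjoint
  have hrat : ∀ x y : ℝ, 1 ≤ x → x ≤ y → f x * (y / x) ^ β ≤ f y := by
    intro x y hx hxy
    have hx0 : 0 < x := by linarith
    have hy0 : 0 < y := by linarith
    have := hB x y hx hxy
    rw [le_div_iff₀ (Real.rpow_pos_of_pos hy0 _)] at this
    rw [Real.div_rpow hy0.le hx0.le]
    calc _ = f x / x ^ β * y ^ β := by ring
      _ ≤ _ := this
  have hmono : ∀ x y : ℝ, 1 ≤ x → x ≤ y → f x ≤ f y := by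
    intro x y hx hxy
    refine le_trans ?_ (hrat x y hx hxy)
    have : 1 ≤ (y / x) ^ β := Real.one_le_rpow ((one_le_div (by linarith)).2 hxy) hβ.le
    nlinarith [hf_pos x hx]
  let F : ℝ → ℝ := fun t => f (max 1 t)
  have hFmono : Monotone F := fun x y hxy => hmono _ _ (le_max_left _ _) (max_le_max le_rfl hxy)
  have hFm : Measurable F := hFmono.measurable
  have hFe : ∀ u : ℝ, 0 ≤ u → F (Real.exp u) = f (Real.exp u) := by
    intro u hu
    simp only [F]; rw [max_eq_right (Real.one_le_exp hu)]
  have hf1 : 0 < f 1 := hf_pos 1 le_rfl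
  let X : ℝ → Ω → ℝ := fun u ω => V (f (Real.exp u)) ω / √(F (Real.exp u))
  have hXm : Measurable (Function.uncurry X) := by
    have h1 : Measurable (fun q : ℝ × Ω => Function.uncurry (fun (t : ℝ) (ω : Ω) => V (f t) ω) (Real.exp q.1, q.2)) :=
      hjoint.comp (by fun_prop)
    have h2 : Measurable (fun q : ℝ × Ω => √(F (Real.exp q.1))) :=
      (hFm.comp (by fun_prop)).sqrt
    exact h1.div h2
  have hfexp : Tendsto (fun u : ℝ => f (Real.exp u)) atTop atTop := by
    have h1 : Tendsto (fun u : ℝ => f 1 * (Real.exp u) ^ β) atTop atTop :=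
      ((_root_.tendsto_rpow_atTop hβ).comp Real.tendsto_exp_atTop).const_mul_atTop hf1
    refine tendsto_atTop_mono' _ ?_ h1
    filter_upwards [eventually_ge_atTop 0] with u hu
    have := hrat 1 (Real.exp u) le_rfl (Real.one_le_exp hu)
    simpa using this
  -- the key almost sure convergence for one Lipschitz function
  have key : ∀ (g : ℝ → ℝ) (L : ℝ≥0), (∀ x, |g x| ≤ 1) → LipschitzWith L g →
      ∀ᵐ ω ∂P, Tendsto (fun S : ℝ => (1 / S) * ∫ u in (0:ℝ)..S, g (X u ω)) atTop
        (𝓝 (∫ y, g y ∂(gaussianReal 0 (σ ^ 2)))) := by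
    intro g L hg1 hgL
    have hgXm : Measurable (Function.uncurry fun u ω => g (X u ω)) := hgL.continuous.measurable.comp hXm
    let e : ℝ → ℝ := fun u => ∫ ω, g (X u ω) ∂P
    have hem : Measurable e := (hgXm.stronglyMeasurable.integral_prod_right (ν := P)).measurable
    have heb : ∀ u, |e u| ≤ 1 := by
      intro u
      have := norm_integral_le_of_norm_le_const (μ := P) (C := 1) (f := fun ω => g (X u ω)) (ae_of_all _ fun _ => hg1 _)
      simpa using this
    have hel : Tendsto e atTop (𝓝 (∫ y, g y ∂(gaussianReal 0 (σ ^ 2)))) := by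
      refine ((h.clt hm g 1 hg1 L hgL).comp hfexp).congr' ?_
      filter_upwards [eventually_ge_atTop 0] with u hu
      simp only [Function.comp, e, X, hFe u hu]
    have hces := cesaro_int e hem 1 _ heb hel
    have hYm : Measurable (Function.uncurry fun u ω => g (X u ω) - e u) :=
      hgXm.sub (hem.comp measurable_fst)
    have hcov : ∀ u v, 0 ≤ u → u ≤ v → |∫ ω, (g (X u ω) - e u) * (g (X v ω) - e v) ∂P| ≤
        (2 * 1 * L * σ * √(1 + 1 / f 1)) * Real.exp (-(β / 2) * (v - u)) := by
      intro u v hu huv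
      have hx1 := Real.one_le_exp hu
      have hxy : Real.exp u ≤ Real.exp v := Real.exp_le_exp.2 huv
      have hc := h.cov_bound hm g 1 hg1 L hgL (f (Real.exp u)) (f (Real.exp v)) (hf_pos _ hx1)
        (hmono _ _ hx1 hxy)
      simp only [e, X, hFe u hu, hFe v (hu.trans huv)]
      refine hc.trans ?_
      have ha := hf_pos _ hx1
      have hb := hf_pos _ (hx1.trans hxy)
      have hr := hrat _ _ hx1 hxy
      have h1a := hmono 1 _ le_rfl hx1
      set a := f (Real.exp u)
      set b := f (Real.exp v)
      rw [mul_assoc (2 * 1 * (L:ℝ) * σ)]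
      have hLσ : (0:ℝ) ≤ 2 * 1 * L * σ := by positivity
      refine mul_le_mul_of_nonneg_left ?_ hLσ
      have e1 : Real.exp (-(β / 2) * (v - u)) = √(Real.exp (-β * (v - u))) := by
        rw [← Real.exp_half]; congr 1; ring
      rw [e1, ← Real.sqrt_mul (by positivity), ← Real.sqrt_div (by positivity)]
      refine Real.sqrt_le_sqrt ?_
      rw [div_le_iff₀ hb]
      have e2 : (Real.exp v / Real.exp u) ^ β = Real.exp (β * (v - u)) := by
        rw [← Real.exp_sub, ← Real.exp_mul]; congr 1; ring
      rw [e2] at hr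
      have e3 : a ≤ Real.exp (-β * (v - u)) * b := by
        calc a = Real.exp (-β * (v - u)) * (a * Real.exp (β * (v - u))) := by
              rw [mul_left_comm, ← Real.exp_add]; simp
          _ ≤ _ := by gcongr
      have e4 : a + 1 ≤ (1 + 1 / f 1) * a := by
        have : 1 ≤ 1 / f 1 * a := by
          rw [div_mul_eq_mul_div, one_mul, le_div_iff₀ hf1]; linarith
        linarith
      calc a + 1 ≤ (1 + 1 / f 1) * a := e4
        _ ≤ (1 + 1 / f 1) * (Real.exp (-β * (v - u)) * b) := by gcongr
        _ = _ := by ring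
    have hs := slln_cont P (fun u ω => g (X u ω) - e u) hYm 2
      (fun u ω => (abs_sub _ _).trans (by linarith [hg1 (X u ω), heb u])) _ (β / 2) (by positivity) hcov
    filter_upwards [hs] with ω hω
    have := hω.add hces
    rw [zero_add] at this
    refine this.congr fun S => ?_
    have hi : ∀ k : ℝ → ℝ, Measurable k → (∀ u, |k u| ≤ 1) → IntervalIntegrable k volume 0 S := by
      intro k hk hk1
      exact (intervalIntegrable_const (c := (1:ℝ))).mono_fun hk.aestronglyMeasurable
        (ae_of_all _ fun u => (hk1 u).trans (by simp))
    rw [← mul_add, intervalIntegral.integral_sub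
      (hi (fun u => g (X u ω)) (hgXm.comp measurable_prodMk_right) fun u => hg1 _) (hi e hem heb)]
    ring
  obtain ⟨H, hH, hconv⟩ := exists_countable_class
  have hae : ∀ᵐ ω ∂P, ∀ A n, Tendsto (fun S : ℝ => (1 / S) * ∫ u in (0:ℝ)..S, H A n (X u ω)) atTop
        (𝓝 (∫ y, H A n y ∂(gaussianReal 0 (σ ^ 2)))) := by
    rw [ae_all_iff]; intro A
    rw [ae_all_iff]; intro n
    obtain ⟨h1, L, hL⟩ := hH A n
    exact key (H A n) L h1 hL
  filter_upwards [hae] with ω hω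
  have hXω : Measurable fun u => X u ω := hXm.comp measurable_prodMk_right
  have hpr : IsProbabilityMeasure (volume.restrict (Set.Ioc (0:ℝ) 1)) := ⟨by simp⟩
  have hmS : ∀ S : ℝ, Measurable fun x : ℝ => X (S * x) ω := fun S => hXω.comp (measurable_const_mul S)
  let μs : ℝ → ProbabilityMeasure ℝ := fun S =>
    ⟨(volume.restrict (Set.Ioc (0:ℝ) 1)).map (fun x => X (S * x) ω),
      Measure.isProbabilityMeasure_map (hmS S).aemeasurable⟩
  have hint : ∀ (k : ℝ → ℝ), Continuous k → ∀ S : ℝ, 0 < S →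
      ∫ y, k y ∂(μs S : Measure ℝ) = (1 / S) * ∫ u in (0:ℝ)..S, k (X u ω) := by
    intro k hk S hS
    have e1 : ∫ y, k y ∂(μs S : Measure ℝ) = ∫ x in (0:ℝ)..1, k (X (S * x) ω) := by
      rw [intervalIntegral.integral_of_le zero_le_one]
      exact integral_map (hmS S).aemeasurable hk.aestronglyMeasurable
    rw [e1, intervalIntegral.integral_comp_mul_left (fun u => k (X u ω)) hS.ne']
    simp
  have hw := hconv μs ⟨gaussianReal 0 (σ ^ 2), inferInstance⟩ (by
    intro A n
    obtain ⟨_, L, hL⟩ := hH A n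
    refine (hω A n).congr' ?_
    filter_upwards [eventually_gt_atTop 0] with S hS
    rw [hint _ hL.continuous S hS])
  intro g
  have hg := (ProbabilityMeasure.tendsto_iff_forall_integral_tendsto.1 hw g).comp Real.tendsto_log_atTop
  refine hg.congr' ?_
  filter_upwards [eventually_gt_atTop 1] with T hT
  have hlog : 0 < Real.log T := Real.log_pos hT
  simp only [Function.comp]
  rw [hint g g.continuous _ hlog]
  congr 1
  rw [intervalIntegral.integral_of_le hlog.le, intervalIntegral.integral_of_le hT.le]
  have himg : Real.exp '' Set.Ioc 0 (Real.log T) = Set.Ioc 1 T := by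
    ext t
    constructor
    · rintro ⟨u, hu, rfl⟩
      exact ⟨Real.one_lt_exp_iff.2 hu.1, (Real.le_log_iff_exp_le (by linarith)).1 hu.2⟩
    · rintro ⟨h1, h2⟩
      exact ⟨Real.log t, ⟨Real.log_pos h1, Real.log_le_log (by linarith) h2⟩, Real.exp_log (by linarith)⟩
  rw [← himg, integral_image_eq_integral_abs_deriv_smul measurableSet_Ioc
    (fun x _ => (Real.hasDerivAt_exp x).hasDerivWithinAt) Real.exp_injective.injOn]
  refine setIntegral_congr_fun measurableSet_Ioc fun u hu => ?_
  have hu0 : 0 ≤ u := hu.1.le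
  have hep := Real.exp_pos u
  simp only [X, hFe u hu0, smul_eq_mul, abs_of_pos hep]
  field_simp
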